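/- arXiv:1812.04704 — 3 statements merged into one kernel-verified Lean document; each statement's English description precedes it below -/
import Mathlib

section
/- Let X be an abelian group with automorphism t : X → X such that 1−t is also an automorphism, made into an Alexander quandle by a * b = t a + (1−t) b. Then the correspondence sending the generator (x,y) of ℤ⟨X×X⟩ to x ⊗ (1−t)y ∈ X ⊗_ℤ X induces an isomorphism of abelian groups H₂^Q(X) ≅ (X ⊗_ℤ X) / N, where N is the subgroup of X ⊗_ℤ X generated by all elements x ⊗ y − y ⊗ t x with x, y ∈ X. -/
open FreeAbelianGroup TensorProduct

/-- A normalized Alexander cocycle, reparametrized, is bilinear. -/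
theorem alex_cocycle_bilinear {X A : Type*} [AddCommGroup X] [AddCommGroup A]
    (t s : X ≃+ X) (hs : ∀ x, s x = x - t x) (g : X → X → A)
    (h0 : ∀ c, g 0 c = 0) (hd : ∀ a, g a (s a) = 0)
    (hc : ∀ x b c, g x c - g (t x + b) c - g x b + g (t x + c) (t b + s c) = 0) :
    (∀ x y z, g (x + y) z = g x z + g y z) ∧ (∀ x y z, g x (y + z) = g x y + g x z) ∧
      ∀ x y, g x y = g y (t x) := by
  have hst : ∀ x, s x + t x = x := fun x => by rw [hs]; abel
  have hts : ∀ x, t x + s x = x := fun x => by rw [hs]; abel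
  have h1 : ∀ b c, g b c = g c (t b + s c) := by
    intro b c
    have := hc 0 b c
    simp only [h0, map_zero, zero_add, zero_sub, sub_zero] at this
    exact (neg_add_eq_zero.mp this)
  have hz : ∀ b, g b 0 = 0 := by
    intro b
    rw [h1 b 0, h0]
  have ht : ∀ x b, g (t x) (t b) = g x b := by
    intro x b
    have := hc x b 0
    simp only [hz, map_zero, add_zero, sub_zero, zero_sub] at this
    exact (neg_add_eq_zero.mp this).symm
  have hco : ∀ p x c, g p (t x + c) - g p (t x) = g (p + x) c - g x c := by
    intro p x c
    have e1 := hc x (p + s x) c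
    have e2 : t x + (p + s x) = p + x := by rw [hs]; abel
    have e3 := h1 p (t x + c)
    have e4 : t p + s (t x + c) = t (p + s x) + s c := by
      simp only [hs, map_add, map_sub]; abel
    have e5 := h1 (t.symm p) x
    rw [t.apply_symm_apply] at e5
    have e6 := ht (t.symm p) x
    rw [t.apply_symm_apply] at e6
    rw [e2, ← e4, ← e3, ← e5, ← e6] at e1
    have : g p (t x + c) - g p (t x) - (g (p + x) c - g x c) = 0 := by
      rw [← e1]; abel
    exact sub_eq_zero.mp this
  obtain ⟨h, hh⟩ : ∃ h : X → X → A, ∀ x y, h x y = g x (t y) := ⟨_, fun _ _ => rfl⟩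
  have hg : ∀ x y, g x y = h x (t.symm y) := fun x y => by rw [hh, t.apply_symm_apply]
  have co : ∀ p x w, h p x + h (p + x) w = h x w + h p (x + w) := by
    intro p x w
    have := hco p x (t w)
    rw [← map_add, ← hh, ← hh, ← hh, ← hh] at this
    have e : h p x + h (p + x) w - (h x w + h p (x + w)) = 0 := by
      have := sub_eq_zero.mpr this
      rw [← neg_eq_zero, ← this]; abel
    exact sub_eq_zero.mp e
  have k1 : ∀ b w, h b w = h (t w) (b + s w) := by
    intro b w
    rw [hh, hh, h1]
    congr 1
    simp only [hs, map_add, map_sub]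
  have k2 : ∀ a, h (t a) (s a) = 0 := by
    intro a
    rw [hh, ht, hd]
  have hcomm : ∀ b w, h b (s w) = h (t w) b - h b (t w) := by
    intro b w
    have e1 := co (t w) b (s w)
    have e2 := co b (t w) (s w)
    rw [k2, hts, zero_add] at e2
    rw [← k1, ← e2, add_comm (t w) b] at e1
    have := sub_eq_zero.mpr e1
    rw [← sub_eq_zero, ← neg_eq_zero, ← this]; abel
  have cadd : ∀ x y z, h (x + y) z - h z (x + y) = (h x z - h z x) + (h y z - h z y) := by
    intro x y z
    have e1 := sub_eq_zero.mpr (co x y z)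
    have e2 := sub_eq_zero.mpr (co z x y)
    have e3 := sub_eq_zero.mpr (co x z y)
    rw [add_comm z x] at e2
    rw [add_comm z y] at e3
    rw [← sub_eq_zero]
    have : (h x y + h (x + y) z - (h y z + h x (y + z)))
      + (h z x + h (x + z) y - (h x y + h z (x + y)))
      - (h x z + h (x + z) y - (h z y + h x (y + z))) = 0 := by
        rw [e1, e2, e3]; simp
    rw [← this]; abel
  have hr : ∀ b x y, h b (x + y) = h b x + h b y := by
    intro b x y
    obtain ⟨x, rfl⟩ := s.surjective x
    obtain ⟨y, rfl⟩ := s.surjective y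
    rw [← map_add, hcomm, hcomm, hcomm, map_add, cadd]
  have hl : ∀ x y b, h (x + y) b = h x b + h y b := by
    intro x y b
    have := co x y b
    rw [hr] at this
    have := sub_eq_zero.mpr this
    rw [← sub_eq_zero, ← this]; abel
  refine ⟨fun x y z => ?_, fun x y z => ?_, fun x y => ?_⟩
  · simp only [hg, hl]
  · simp only [hg, map_add, hr]
  · rw [h1, hg, map_add, hr, ← hg, ← hg, hd, add_zero]

/-- **Theorem (second quandle homology of Alexander quandles).**
Let `X` be an abelian group with automorphism `t` such that `1 - t` (called `s` here,
`s x = x - t x`) is also an automorphism, made into an Alexander quandle by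
`op a b = t a + (1 - t) b`.  Then the correspondence sending the generator `(x, y)` of
`ℤ⟨X × X⟩` to `x ⊗ (1 - t) y` induces an isomorphism
`H₂^Q(X) = ker d2 / (im d3 + ⟨(a,a)⟩) ≅ (X ⊗ X) / N`,
where `N` is generated by all `x ⊗ y - y ⊗ t x`. -/
theorem second_quandle_homology_of_alexander_quandle
    {X : Type*} [AddCommGroup X] (t s : X ≃+ X) (hs : ∀ x, s x = x - t x)
    (op : X → X → X) (hop : ∀ a b, op a b = t a + s b)
    (d2 : FreeAbelianGroup (X × X) →+ FreeAbelianGroup X)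
    (hd2 : d2 = FreeAbelianGroup.lift fun p : X × X => of p.1 - of (op p.1 p.2))
    (d3 : FreeAbelianGroup (X × X × X) →+ FreeAbelianGroup (X × X))
    (hd3 : d3 = FreeAbelianGroup.lift fun p : X × X × X =>
      of (p.1, p.2.2) - of (op p.1 p.2.1, p.2.2) - of (p.1, p.2.1)
        + of (op p.1 p.2.2, op p.2.1 p.2.2))
    (B : AddSubgroup (FreeAbelianGroup (X × X)))
    (hB : B = d3.range ⊔ AddSubgroup.closure (Set.range fun a : X => of (a, a)))
    (N : AddSubgroup (X ⊗[ℤ] X))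
    (hN : N = AddSubgroup.closure {z | ∃ x y : X, z = x ⊗ₜ[ℤ] y - y ⊗ₜ[ℤ] t x}) :
    ∃ e : (d2.ker ⧸ B.addSubgroupOf d2.ker) ≃+ ((X ⊗[ℤ] X) ⧸ N),
      ∀ z : d2.ker, e (QuotientAddGroup.mk z) =
        QuotientAddGroup.mk ((FreeAbelianGroup.lift
          fun p : X × X => (p.1 ⊗ₜ[ℤ] s p.2 : X ⊗[ℤ] X)) z.1) := by
  have hst : ∀ x, s (t x) = t (s x) := fun x => by simp only [hs, map_sub]
  have oself : ∀ a, op a a = a := fun a => by rw [hop, hs]; abel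
  have odist : ∀ x y z, op (op x y) z = op (op x z) (op y z) := by
    intro x y z
    simp only [hop, hs, map_add, map_sub]; abel
  have d2of : ∀ x y, d2 (of (x, y)) = of x - of (op x y) := by
    intro x y; rw [hd2, lift_apply_of]
  have d3of : ∀ x y z, d3 (of (x, y, z)) = of (x, z) - of (op x y, z) - of (x, y)
        + of (op x z, op y z) := by
    intro x y z; rw [hd3, lift_apply_of]
  have dd : ∀ x y z, d2 (d3 (of (x, y, z))) = 0 := by
    intro x y z
    rw [d3of]
    simp only [map_sub, map_add, d2of, odist x y z]
    abel
  obtain ⟨φ, hφ⟩ : ∃ φ : FreeAbelianGroup (X × X) →+ X ⊗[ℤ] X, φ = FreeAbelianGroup.lift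
          fun p : X × X => (p.1 ⊗ₜ[ℤ] s p.2 : X ⊗[ℤ] X) := ⟨_, rfl⟩
  have φof : ∀ x y, φ (of (x, y)) = x ⊗ₜ[ℤ] s y := by
    intro x y; rw [hφ, lift_apply_of]
  rw [← hφ]
  -- the section and the projection to the kernel
  obtain ⟨σ, hσ⟩ : ∃ σ : FreeAbelianGroup X →+ FreeAbelianGroup (X × X),
      ∀ x, σ (of x) = - of (0, s.symm x) :=
    ⟨FreeAbelianGroup.lift fun x => - of (0, s.symm x), fun x => by rw [lift_apply_of]⟩
  have dσ : ∀ z, d2 (σ (d2 z)) = d2 z := by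
    intro z
    have : (d2.comp (σ.comp d2)) = d2 := by
      ext ⟨x, y⟩
      simp only [AddMonoidHom.comp_apply, d2of, map_sub, hσ, map_neg, hop, map_zero, zero_add,
        AddEquiv.apply_symm_apply]
      abel
    exact DFunLike.congr_fun this z
  have φσ : ∀ z, φ (σ z) = 0 := by
    intro z
    have : φ.comp σ = 0 := by
      ext x
      simp [hσ, φof]
    exact DFunLike.congr_fun this z
  -- relations in the tensor quotient
  have rel : ∀ x y : X, (QuotientAddGroup.mk' N) (x ⊗ₜ[ℤ] y)
      = (QuotientAddGroup.mk' N) (y ⊗ₜ[ℤ] t x) := by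
    intro x y
    rw [← sub_eq_zero, ← map_sub, ← AddMonoidHom.mem_ker, QuotientAddGroup.ker_mk', hN]
    exact AddSubgroup.subset_closure ⟨x, y, rfl⟩
  have rel2 : ∀ x y : X, (QuotientAddGroup.mk' N) (t x ⊗ₜ[ℤ] t y)
      = (QuotientAddGroup.mk' N) (x ⊗ₜ[ℤ] y) := by
    intro x y
    rw [← rel, ← rel]
  have hBφ : B ≤ ((QuotientAddGroup.mk' N).comp φ).ker := by
    rw [hB, sup_le_iff, AddSubgroup.closure_le]
    constructor
    · rintro _ ⟨w, rfl⟩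
      have : ((QuotientAddGroup.mk' N).comp φ).comp d3 = 0 := by
        ext ⟨x, y, z⟩
        rw [AddMonoidHom.comp_apply, AddMonoidHom.comp_apply, d3of]
        simp only [map_sub, map_add, φof, hop, hst, TensorProduct.add_tmul, TensorProduct.tmul_add,
          rel2]
        rw [← rel (s y) (s z), hs (s z)]
        simp only [TensorProduct.tmul_sub, map_sub, rel2]
        rw [← rel (s z) (s z)]
        rw [AddMonoidHom.zero_apply]
        abel
      exact DFunLike.congr_fun this w
    · rintro _ ⟨a, rfl⟩
      simp only [SetLike.mem_coe, AddMonoidHom.mem_ker, AddMonoidHom.comp_apply, φof, hs a,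
        TensorProduct.tmul_sub, map_sub]
      rw [← rel, sub_self]
  -- the inverse
  obtain ⟨π, hπ⟩ : ∃ π : FreeAbelianGroup (X × X) →+ (FreeAbelianGroup (X × X)) ⧸ B,
      ∀ z, π z = QuotientAddGroup.mk' B (z - σ (d2 z)) :=
    ⟨(QuotientAddGroup.mk' B).comp (AddMonoidHom.id _ - σ.comp d2), fun z => rfl⟩
  have mkB : ∀ z ∈ B, QuotientAddGroup.mk' B z = 0 := by
    intro z hz
    rwa [← AddMonoidHom.mem_ker, QuotientAddGroup.ker_mk']
  have Baa : ∀ a : X, of (a, a) ∈ B := by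
    intro a
    rw [hB]
    exact AddSubgroup.mem_sup_right (AddSubgroup.subset_closure ⟨a, rfl⟩)
  have Bd3 : ∀ w, d3 w ∈ B := by
    intro w
    rw [hB]
    exact AddSubgroup.mem_sup_left ⟨w, rfl⟩
  have π0 : ∀ y, π (of (0, y)) = 0 := by
    intro y
    rw [hπ, d2of, hop]
    apply mkB
    have := Baa 0
    simpa [hσ] using this
  have πd : ∀ a, π (of (a, a)) = 0 := by
    intro a
    rw [hπ, d2of, oself, sub_self, map_zero, sub_zero]
    exact mkB _ (Baa a)
  have πc : ∀ x y z, π (of (x, z)) - π (of (op x y, z)) - π (of (x, y))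
        + π (of (op x z, op y z)) = 0 := by
    intro x y z
    rw [← map_sub, ← map_sub, ← map_add, ← d3of, hπ, dd, map_zero, sub_zero]
    exact mkB _ (Bd3 _)
  obtain ⟨g, hg⟩ : ∃ g : X → X → (FreeAbelianGroup (X × X)) ⧸ B,
      ∀ x y, g x y = π (of (x, s.symm y)) := ⟨_, fun _ _ => rfl⟩
  obtain ⟨gl, gr, gs⟩ := alex_cocycle_bilinear t s hs g (fun c => by rw [hg, π0])
    (fun a => by rw [hg, s.symm_apply_apply, πd]) (fun x b c => by
      have := πc x (s.symm b) (s.symm c)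
      have e : s.symm (t b + s c) = op (s.symm b) (s.symm c) := by
        rw [AddEquiv.symm_apply_eq, hop, map_add, hst]
        simp
      simp only [hg, e]
      rw [hop x, hop x] at this
      simpa using this)
  obtain ⟨ψ, hψ⟩ : ∃ ψ : X ⊗[ℤ] X →+ (FreeAbelianGroup (X × X)) ⧸ B,
      ∀ x y, ψ (x ⊗ₜ[ℤ] y) = g x y :=
    ⟨(TensorProduct.lift (AddMonoidHom.toIntLinearMap (AddMonoidHom.mk'
      (fun x => (AddMonoidHom.mk' (g x) (gr x)).toIntLinearMap)
      (fun x y => by ext z; exact gl x y z)))).toAddMonoidHom, fun x y => by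
        simp⟩
  have ψN : N ≤ ψ.ker := by
    rw [hN, AddSubgroup.closure_le]
    rintro _ ⟨x, y, rfl⟩
    rw [SetLike.mem_coe, AddMonoidHom.mem_ker, map_sub, hψ, hψ, gs x y, sub_self]
  have ψφ : ∀ z, ψ (φ z) = π z := by
    intro z
    have : ψ.comp φ = π := by
      ext ⟨x, y⟩
      simp [φof, hψ, hg]
    exact DFunLike.congr_fun this z
  have φsurj : Function.Surjective φ := by
    intro v
    induction v using TensorProduct.induction_on with
    | zero => exact ⟨0, map_zero _⟩
    | tmul x y => exact ⟨of (x, s.symm y), by rw [φof, s.apply_symm_apply]⟩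
    | add a b ha hb =>
      obtain ⟨a, rfl⟩ := ha
      obtain ⟨b, rfl⟩ := hb
      exact ⟨a + b, map_add _ _ _⟩
  let F : d2.ker →+ (X ⊗[ℤ] X) ⧸ N := ((QuotientAddGroup.mk' N).comp φ).comp d2.ker.subtype
  have hF : ∀ z, F z = QuotientAddGroup.mk' N (φ z.1) := fun _ => rfl
  let G : (d2.ker ⧸ B.addSubgroupOf d2.ker) →+ ((X ⊗[ℤ] X) ⧸ N) :=
    QuotientAddGroup.lift _ F (fun z hz => hBφ hz)
  have hG : ∀ z : d2.ker, G (QuotientAddGroup.mk z) = QuotientAddGroup.mk (φ z.1) := fun _ => rfl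
  refine ⟨AddEquiv.ofBijective G ⟨?_, ?_⟩, fun z => hG z⟩
  · rw [injective_iff_map_eq_zero]
    intro q
    obtain ⟨z, rfl⟩ := QuotientAddGroup.mk_surjective q
    intro hz
    rw [hG, QuotientAddGroup.eq_zero_iff] at hz
    have h1 : ψ (φ z.1) = 0 := ψN hz
    rw [ψφ, hπ, AddMonoidHom.mem_ker.mp z.2, map_zero, sub_zero] at h1
    rw [QuotientAddGroup.eq_zero_iff, AddSubgroup.mem_addSubgroupOf]
    exact (QuotientAddGroup.eq_zero_iff _).mp h1
  · intro v
    obtain ⟨v, rfl⟩ := QuotientAddGroup.mk_surjective v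
    obtain ⟨z, rfl⟩ := φsurj v
    refine ⟨QuotientAddGroup.mk ⟨z - σ (d2 z), ?_⟩, ?_⟩
    · rw [AddMonoidHom.mem_ker, map_sub, dσ, sub_self]
    · rw [hG, map_sub, φσ, sub_zero]
end

section
/- Let p be a prime and n a positive integer with gcd(n,p) = 1. Let X = 𝔽_p[T]/(Φ_n) where Φ_n = 1 + T + ⋯ + T^{n−1}, and let t : X → X be multiplication by the class of T. Let M be the 𝔽_p-subspace of the second exterior power Λ²_{𝔽_p} X generated by all elements x ∧ y − t x ∧ t y. Then the quotient (Λ²_{𝔽_p} X)/M is isomorphic as an abelian group to (ℤ/p)^⌊(n−1)/2⌋; equivalently, it is an 𝔽_p-vector space of dimension ⌊(n−1)/2⌋. -/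
open TensorProduct Polynomial

lemma aux_root_pow {p n : ℕ} [Fact p.Prime] (Φ : Polynomial (ZMod p))
    (hΦ : Φ = ∑ i ∈ Finset.range n, Polynomial.X ^ i) :
    (∑ i ∈ Finset.range n, AdjoinRoot.root Φ ^ i = 0) ∧ AdjoinRoot.root Φ ^ n = 1 := by
  have h0 : ∑ i ∈ Finset.range n, AdjoinRoot.root Φ ^ i = 0 := by
    have h := AdjoinRoot.mk_self (f := Φ)
    conv at h => lhs; arg 2; rw [hΦ]
    simpa using h
  refine ⟨h0, ?_⟩
  have h := mul_geom_sum (AdjoinRoot.root Φ) n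
  rw [h0, mul_zero] at h
  exact (sub_eq_zero.mp h.symm)

lemma aux_periodic_sum {R : Type*} [AddCommMonoid R] (n : ℕ) (g : ℕ → R)
    (hg : ∀ i, g (i + n) = g i) (i : ℕ) :
    ∑ l ∈ Finset.range n, g (i + l) = ∑ l ∈ Finset.range n, g l := by
  induction i with
  | zero => simp
  | succ i ih =>
    rw [← ih]
    cases n with
    | zero => simp
    | succ n =>
      rw [Finset.sum_range_succ, Finset.sum_range_succ' (fun l => g (i + l))]
      congr 1
      · refine Finset.sum_congr rfl fun l _ => ?_
        congr 1; omega
      · rw [← hg (i + 0)]; congr 1; omega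

lemma aux_functional {p n : ℕ} [Fact p.Prime] (hn : 0 < n) (hnp : Nat.gcd n p = 1)
    (Φ : Polynomial (ZMod p))
    (hΦ : Φ = ∑ i ∈ Finset.range n, Polynomial.X ^ i) (j : ℕ) (hj : j < n) :
    ∃ d : AdjoinRoot Φ →ₗ[ZMod p] ZMod p, ∀ i, d (AdjoinRoot.root Φ ^ i) =
      (if i % n = j then 1 else 0) - (n : ZMod p)⁻¹ := by
  have hn0 : (n : ZMod p) ≠ 0 := by
    intro h
    rw [ZMod.natCast_eq_zero_iff] at h
    have h1 := Nat.gcd_eq_right h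
    exact (Fact.out : p.Prime).one_lt.ne' (h1.symm.trans hnp)
  set g : ℕ → ZMod p := fun i => (if i % n = j then 1 else 0) - (n : ZMod p)⁻¹ with hgdef
  have hper : ∀ i, g (i + n) = g i := by intro i; simp [hgdef]
  have hsum : ∑ l ∈ Finset.range n, g l = 0 := by
    simp only [hgdef, Finset.sum_sub_distrib]
    rw [Finset.sum_congr rfl (g := fun l => if l = j then (1 : ZMod p) else 0)]
    · simp [hj, hn0]
    · intro l hl
      rw [Nat.mod_eq_of_lt (Finset.mem_range.mp hl)]
  let f : (ZMod p)[X] →ₗ[ZMod p] ZMod p := (Polynomial.basisMonomials (ZMod p)).constr (ZMod p) g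
  have hf : ∀ i, f (X ^ i) = g i := by
    intro i
    have := (Polynomial.basisMonomials (ZMod p)).constr_basis (ZMod p) g i
    simp only [Polynomial.coe_basisMonomials, Polynomial.monomial_one_right_eq_X_pow] at this
    exact this
  have hker : ∀ q : (ZMod p)[X], f (q * Φ) = 0 := by
    intro q
    induction q using Polynomial.induction_on' with
    | add a b ha hb => rw [add_mul, map_add, ha, hb, add_zero]
    | monomial i a =>
      rw [← Polynomial.C_mul_X_pow_eq_monomial, mul_assoc, ← Polynomial.smul_eq_C_mul, map_smul]
      have : f (X ^ i * Φ) = 0 := by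
        rw [hΦ, Finset.mul_sum, map_sum]
        simp only [← pow_add, hf]
        rw [aux_periodic_sum n g hper, hsum]
      rw [this, smul_zero]
  let I : Submodule (ZMod p) (ZMod p)[X] := (Ideal.span {Φ}).restrictScalars (ZMod p)
  have hI : I ≤ LinearMap.ker f := by
    intro x hx
    obtain ⟨a, rfl⟩ := Ideal.mem_span_singleton'.mp (show x ∈ Ideal.span {Φ} from hx)
    exact hker a
  let d0 := (I.liftQ f hI).comp
    (Submodule.Quotient.restrictScalarsEquiv (ZMod p) (Ideal.span {Φ})).symm.toLinearMap
  let d1 : AdjoinRoot Φ →+ ZMod p := d0.toAddMonoidHom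
  refine ⟨d1.toZModLinearMap p, fun i => ?_⟩
  rw [← hgdef] at *
  show _ = g i
  rw [← hf i, ← AdjoinRoot.mk_X, ← map_pow]
  rfl

lemma aux_sigma {p n : ℕ} [Fact p.Prime] (hn : 0 < n) (Φ : Polynomial (ZMod p))
    (hΦ : Φ = ∑ i ∈ Finset.range n, Polynomial.X ^ i) :
    ∃ σ : AdjoinRoot Φ →ₐ[ZMod p] AdjoinRoot Φ,
      σ (AdjoinRoot.root Φ) = AdjoinRoot.root Φ ^ (n - 1) ∧
      AdjoinRoot.root Φ * σ (AdjoinRoot.root Φ) = 1 ∧ ∀ x, σ (σ x) = x := by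
  obtain ⟨h0, h1⟩ := aux_root_pow Φ hΦ
  set r := AdjoinRoot.root Φ with hr
  have hrs : r * r ^ (n - 1) = 1 := by
    rw [← pow_succ', Nat.sub_add_cancel hn, h1]
  have hz : ∑ i ∈ Finset.range n, (r ^ (n - 1)) ^ i = 0 := by
    have : r ^ (n - 1) * ∑ i ∈ Finset.range n, (r ^ (n - 1)) ^ i = 0 := by
      rw [← h0, Finset.mul_sum, ← Finset.sum_range_reflect]
      refine Finset.sum_congr rfl fun i hi => ?_
      have hi := Finset.mem_range.mp hi
      have e : r ^ (n - 1) = r ^ i * r ^ (n - 1 - i) := by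
        rw [← pow_add]; congr 1; omega
      have e2 : (r ^ (n - 1)) ^ (n - 1 - i) * r ^ (n - 1 - i) = 1 := by
        rw [← mul_pow, mul_comm, hrs, one_pow]
      calc r ^ (n - 1) * (r ^ (n - 1)) ^ (n - 1 - i)
          = r ^ i * ((r ^ (n - 1)) ^ (n - 1 - i) * r ^ (n - 1 - i)) := by
            conv_lhs => arg 1; rw [e]
            ring
        _ = r ^ i := by rw [e2, mul_one]
    have h2 := congrArg (r * ·) this
    simpa [← mul_assoc, hrs] using h2
  let σ : AdjoinRoot Φ →ₐ[ZMod p] AdjoinRoot Φ :=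
    AdjoinRoot.liftAlgHom Φ (Algebra.ofId _ _) (r ^ (n - 1)) (by
      conv_lhs => arg 3; rw [hΦ]
      rw [Polynomial.eval₂_finsetSum]
      simpa using hz)
  have hσ : σ r = r ^ (n - 1) := by simp [σ, hr]
  have hrσ : r * σ r = 1 := by rw [hσ, hrs]
  refine ⟨σ, hσ, hrσ, ?_⟩
  have hss : σ (σ r) = r := by
    have h3 : σ r * σ (σ r) = 1 := by rw [← map_mul, hrσ, map_one]
    calc σ (σ r) = (r * σ r) * σ (σ r) := by rw [hrσ, one_mul]
      _ = r := by rw [mul_assoc, h3, mul_one]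
  have : σ.comp σ = AlgHom.id _ _ := by
    apply AdjoinRoot.algHom_ext
    simpa using hss
  intro x
  exact DFunLike.congr_fun this x

lemma aux_arith (n i : ℕ) (h : i + 1 ≤ n) :
    (n - 1) * (i + 1) = (n - (i + 1)) + n * i := by
  obtain ⟨m, rfl⟩ : ∃ m, n = m + (i + 1) := ⟨n - (i + 1), by omega⟩
  have e : m + (i + 1) - 1 = m + i := by omega
  have e' : m + (i + 1) - (i + 1) = m := by omega
  rw [e, e']; ring

/-- **Theorem (second homology of the Alexander quandle `𝔽_p[T]/(Φ_n)`).**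
Let `p` be a prime, `n` a positive integer with `gcd n p = 1`.  Let
`X = 𝔽_p[T]/(Φ_n)` where `Φ_n = 1 + T + ⋯ + T^(n-1)`, and let `t : X → X` be
multiplication by the class of `T`.  Let `Λ² X` be the second exterior power of `X`
over `𝔽_p` (the quotient of `X ⊗ X` by the span `Alt` of the elements `x ⊗ x`, with
`wedge x y` the class of `x ⊗ y`) and `M` the subspace generated by all
`x ∧ y - t x ∧ t y`.  Then `(Λ² X)/M ≅ (ℤ/p)^⌊(n-1)/2⌋` as abelian groups. -/
theorem exterior_square_quotient_of_cyclotomic_alexander_quandle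
    (p n : ℕ) [Fact p.Prime] (hn : 0 < n) (hnp : Nat.gcd n p = 1)
    (Φ : Polynomial (ZMod p)) (hΦ : Φ = ∑ i ∈ Finset.range n, Polynomial.X ^ i)
    (t : AdjoinRoot Φ →ₗ[ZMod p] AdjoinRoot Φ)
    (ht : ∀ x, t x = AdjoinRoot.root Φ * x)
    (Alt : Submodule (ZMod p) ((AdjoinRoot Φ) ⊗[ZMod p] (AdjoinRoot Φ)))
    (hAlt : Alt = Submodule.span (ZMod p) {z | ∃ x : AdjoinRoot Φ, z = x ⊗ₜ[ZMod p] x})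
    (wedge : AdjoinRoot Φ → AdjoinRoot Φ →
      ((AdjoinRoot Φ) ⊗[ZMod p] (AdjoinRoot Φ)) ⧸ Alt)
    (hwedge : ∀ x y, wedge x y = Submodule.Quotient.mk (x ⊗ₜ[ZMod p] y))
    (M : Submodule (ZMod p) (((AdjoinRoot Φ) ⊗[ZMod p] (AdjoinRoot Φ)) ⧸ Alt))
    (hM : M = Submodule.span (ZMod p)
      {z | ∃ x y : AdjoinRoot Φ, z = wedge x y - wedge (t x) (t y)}) :
    Nonempty (((((AdjoinRoot Φ) ⊗[ZMod p] (AdjoinRoot Φ)) ⧸ Alt) ⧸ M) ≃+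
      (Fin ((n - 1) / 2) → ZMod p)) := by
  obtain ⟨h0, h1⟩ := aux_root_pow Φ hΦ
  obtain ⟨σ, hσ, hrσ, hσσ⟩ := aux_sigma hn Φ hΦ
  have hd := fun j : Fin ((n - 1) / 2) => aux_functional hn hnp Φ hΦ (j + 1) (by omega)
  choose d hd using hd
  set r := AdjoinRoot.root Φ with hr
  -- the forward map
  let F : (AdjoinRoot Φ) ⊗[ZMod p] (AdjoinRoot Φ) →ₗ[ZMod p] (Fin ((n - 1) / 2) → ZMod p) :=
    LinearMap.pi fun j => (d j - d j ∘ₗ σ.toLinearMap) ∘ₗ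
      LinearMap.mul' (ZMod p) (AdjoinRoot Φ) ∘ₗ TensorProduct.map LinearMap.id σ.toLinearMap
  have hF : ∀ x y j, F (x ⊗ₜ y) j = d j (x * σ y) - d j (σ x * y) := by
    intro x y j
    simp [F, hσσ]
  have hA : Alt ≤ LinearMap.ker F := by
    rw [hAlt, Submodule.span_le]
    rintro _ ⟨x, rfl⟩
    ext j
    rw [hF, mul_comm, sub_self]; rfl
  let G := Alt.liftQ F hA
  have hG : ∀ x y j, G (wedge x y) j = d j (x * σ y) - d j (σ x * y) := by
    intro x y j
    rw [hwedge, ← hF]; rfl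
  have hMk : M ≤ LinearMap.ker G := by
    rw [hM, Submodule.span_le]
    rintro _ ⟨x, y, rfl⟩
    show G _ = 0
    ext j
    rw [map_sub, Pi.sub_apply, hG, hG, ht, ht, map_mul σ, map_mul σ]
    have e1 : r * x * (σ r * σ y) = x * σ y := by
      calc _ = (r * σ r) * (x * σ y) := by ring
        _ = _ := by rw [hrσ, one_mul]
    have e2 : σ r * σ x * (r * y) = σ x * y := by
      calc _ = (r * σ r) * (σ x * y) := by ring
        _ = _ := by rw [hrσ, one_mul]
    rw [e1, e2, sub_self]; rfl
  let H := M.liftQ G hMk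
  -- the class of a wedge
  let q : AdjoinRoot Φ →ₗ[ZMod p] AdjoinRoot Φ →ₗ[ZMod p]
      ((((AdjoinRoot Φ) ⊗[ZMod p] (AdjoinRoot Φ)) ⧸ Alt) ⧸ M) :=
    (TensorProduct.mk (ZMod p) (AdjoinRoot Φ) (AdjoinRoot Φ)).compr₂ (M.mkQ ∘ₗ Alt.mkQ)
  have hq : ∀ x y, q x y = M.mkQ (wedge x y) := by
    intro x y; rw [hwedge]; rfl
  have hH : ∀ x y j, H (q x y) j = d j (x * σ y) - d j (σ x * y) := by
    intro x y j
    rw [hq, ← hG]; rfl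
  have hqs : ∀ x, q x x = 0 := by
    intro x
    have : wedge x x = 0 := by
      rw [hwedge, Submodule.Quotient.mk_eq_zero, hAlt]
      exact Submodule.subset_span ⟨x, rfl⟩
    rw [hq, this, map_zero]
  have hqt : ∀ x y, q (r * x) (r * y) = q x y := by
    intro x y
    rw [hq, hq, eq_comm, ← sub_eq_zero, ← map_sub, Submodule.mkQ_apply,
      Submodule.Quotient.mk_eq_zero, hM]
    exact Submodule.subset_span ⟨x, y, by rw [ht, ht]⟩
  have hqk : ∀ k x y, q (r ^ k * x) (r ^ k * y) = q x y := by
    intro k x y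
    induction k with
    | zero => simp
    | succ k ih => rw [pow_succ', mul_assoc, mul_assoc, hqt, ih]
  have hqn : ∀ x y, q x y = - q y x := by
    intro x y
    have := hqs (x + y)
    simp only [map_add, LinearMap.add_apply, hqs, zero_add, add_zero] at this
    exact eq_neg_of_add_eq_zero_right this
  let ψ : (Fin ((n - 1) / 2) → ZMod p) →ₗ[ZMod p]
      ((((AdjoinRoot Φ) ⊗[ZMod p] (AdjoinRoot Φ)) ⧸ Alt) ⧸ M) :=
    Fintype.linearCombination (ZMod p) fun j : Fin ((n - 1) / 2) => q (r ^ ((j : ℕ) + 1)) 1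
  have hψ : ∀ j : Fin ((n - 1) / 2), ψ (Pi.single j 1) = q (r ^ ((j : ℕ) + 1)) 1 := by
    intro j
    simp [ψ, Fintype.linearCombination_apply_single]
  have hleft : H ∘ₗ ψ = LinearMap.id := by
    apply LinearMap.pi_ext'
    intro i
    ext j
    simp only [LinearMap.comp_apply, LinearMap.single_apply, LinearMap.id_apply]
    rw [hψ, hH, map_one, mul_one, mul_one, map_pow σ, hσ, ← pow_mul, hd, hd]
    have hi := i.2
    have hj := j.2
    have e1 : ((i : ℕ) + 1) % n = i + 1 := Nat.mod_eq_of_lt (by omega)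
    have e2 : ((n - 1) * ((i : ℕ) + 1)) % n = n - (i + 1) := by
      have := aux_arith n i (by omega)
      rw [this, Nat.add_mul_mod_self_left, Nat.mod_eq_of_lt (by omega)]
    rw [e1, e2, if_neg (show ¬ (n - ((i : ℕ) + 1) = j + 1) by omega)]
    by_cases hij : i = j
    · subst hij; simp
    · have : ¬ ((i : ℕ) + 1 = j + 1) := fun h => hij (Fin.ext (by omega))
      rw [if_neg this, Pi.single_eq_of_ne (fun h => hij h.symm)]; simp
  have hinj : Function.Injective ψ := by
    apply Function.LeftInverse.injective (g := H)
    intro v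
    exact DFunLike.congr_fun hleft v
  -- surjectivity
  have hw1 : ∀ i, 0 < i → i ≤ (n - 1) / 2 → q (r ^ i) 1 ∈ LinearMap.range ψ := by
    intro i hi hi'
    refine ⟨Pi.single ⟨i - 1, by omega⟩ 1, ?_⟩
    rw [hψ]
    simp only [Nat.sub_add_cancel hi]
  have hrefl : ∀ i, i ≤ n → q (r ^ (n - i)) 1 = - q (r ^ i) 1 := by
    intro i hi
    rw [← hqk i, ← pow_add, Nat.add_sub_cancel' hi, h1, mul_one, hqn]
  have hw2 : ∀ i, i < n → q (r ^ i) 1 ∈ LinearMap.range ψ := by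
    intro i hi
    rcases Nat.eq_zero_or_pos i with rfl | hi0
    · rw [pow_zero, hqs]; exact zero_mem _
    by_cases hi1 : i ≤ (n - 1) / 2
    · exact hw1 i hi0 hi1
    by_cases hi2 : n - i ≤ (n - 1) / 2
    · have := hrefl i hi.le
      rw [← neg_eq_iff_eq_neg] at this
      rw [← this]
      exact neg_mem (hw1 _ (by omega) hi2)
    · have e : n = 2 * i := by omega
      have h2 := hrefl i hi.le
      rw [show n - i = i by omega] at h2
      have h3 : (2 : ZMod p) • q (r ^ i) 1 = 0 := by
        rw [two_smul]; nth_rewrite 1 [h2]; simp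
      have h4 : (2 : ZMod p) ≠ 0 := by
        intro h
        have h' : ((2 : ℕ) : ZMod p) = 0 := by exact_mod_cast h
        rw [ZMod.natCast_eq_zero_iff] at h'
        have h5 := Nat.gcd_eq_right (h'.trans ⟨i, e⟩)
        exact (Fact.out : p.Prime).one_lt.ne' (h5.symm.trans hnp)
      rw [(smul_eq_zero_iff_right h4).mp h3]
      exact zero_mem _
  have hw3 : ∀ i, q (r ^ i) 1 ∈ LinearMap.range ψ := by
    intro i
    rw [← Nat.mod_add_div i n, pow_add, pow_mul, h1, one_pow, mul_one]
    exact hw2 _ (Nat.mod_lt _ hn)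
  have hw4 : ∀ i j, q (r ^ i) (r ^ j) ∈ LinearMap.range ψ := by
    intro i j
    rcases le_total j i with h | h
    · have := hqk j (r ^ (i - j)) 1
      rw [← pow_add, Nat.add_sub_cancel' h, mul_one] at this
      rw [this]; exact hw3 _
    · have := hqk i (r ^ (j - i)) 1
      rw [← pow_add, Nat.add_sub_cancel' h, mul_one] at this
      rw [hqn, this]; exact neg_mem (hw3 _)
  have hmon : ∀ (i : ℕ) (a : ZMod p), AdjoinRoot.mk Φ (monomial i a) = a • r ^ i := by
    intro i a
    rw [← Polynomial.C_mul_X_pow_eq_monomial, ← Polynomial.smul_eq_C_mul, ← AdjoinRoot.smul_mk,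
      map_pow, AdjoinRoot.mk_X]
  have hw5 : ∀ x y, q x y ∈ LinearMap.range ψ := by
    intro x y
    induction x using AdjoinRoot.induction_on with
    | _ f =>
    induction y using AdjoinRoot.induction_on with
    | _ g =>
    induction f using Polynomial.induction_on' with
    | add a b ha hb => rw [map_add, map_add, LinearMap.add_apply]; exact add_mem ha hb
    | monomial i a =>
      induction g using Polynomial.induction_on' with
      | add a b ha hb => rw [map_add, map_add]; exact add_mem ha hb
      | monomial j b =>
        rw [hmon, hmon, map_smul, map_smul, LinearMap.smul_apply]
        exact Submodule.smul_mem _ _ (Submodule.smul_mem _ _ (hw4 i j))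
  have hsurj : Function.Surjective ψ := by
    intro z
    obtain ⟨z, rfl⟩ := M.mkQ_surjective z
    obtain ⟨z, rfl⟩ := Alt.mkQ_surjective z
    show _ ∈ LinearMap.range ψ
    induction z using TensorProduct.induction_on with
    | zero => simp
    | tmul x y => exact hw5 x y
    | add a b ha hb => rw [map_add, map_add]; exact add_mem ha hb
  exact ⟨(LinearEquiv.ofBijective ψ ⟨hinj, hsurj⟩).symm.toAddEquiv⟩
end

section
/- Let X be an abelian group with automorphism t : X → X such that 1−t is also an automorphism. Let G be the quotient of the free abelian group ℤ⟨X×X⟩ by the subgroup generated by the elements (a,(1−t)a), (a,0), (0,a) for all a ∈ X, and the elements (x,z) − (x,y) − (tx+y, z) + (tx+z, ty+(1−t)z) for all x,y,z ∈ X; write [a,b] for the class of (a,b) in G. Then the bracket is biadditive: [x + y, z] = [x, z] + [y, z] and [x, y + z] = [x, y] + [x, z] in G for all x, y, z ∈ X. -/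
open FreeAbelianGroup TensorProduct

/-- Alternation of a 2-cocycle on an abelian group is biadditive. -/
theorem comm_biadd {X G : Type*} [AddCommGroup X] [AddCommGroup G] (k : X → X → G)
    (K : ∀ x y z, k x y + k (x + y) z = k x (y + z) + k y z) :
    (∀ x y z, k (x + y) z - k z (x + y) = (k x z - k z x) + (k y z - k z y)) := by
  intro x y z
  have h1 := K x y z
  have h2 := K x z y
  have h3 := K z x y
  rw [add_comm z y] at h2
  rw [add_comm z x] at h3
  have e1 : k (x + y) z = k x (y + z) + k y z - k x y := by rw [← h1]; abel
  have e2 : k x (y + z) = k x z + k (x + z) y - k z y := by rw [h2]; abel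
  have e3 : k (x + z) y = k z (x + y) + k x y - k z x := by rw [← h3]; abel
  rw [e1, e2, e3]; abel

theorem biadd_aux {X G : Type*} [AddCommGroup X] [AddCommGroup G] (t : X ≃+ X)
    (ht : Function.Bijective fun x : X => x - t x) (f : X → X → G)
    (h1 : ∀ a, f a (a - t a) = 0) (h2 : ∀ a, f a 0 = 0) (h3 : ∀ a, f 0 a = 0)
    (R : ∀ x y z, f x y + f (t x + y) z = f x z + f (t x + z) (t y + (z - t z))) :
    (∀ x y z : X, f (x + y) z = f x z + f y z) ∧
      (∀ x y z : X, f x (y + z) = f x y + f x z) := by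
  have T : ∀ x y, f (t x) (t y) = f x y := by
    intro x y
    simpa [h2] using (R x y 0).symm
  have A : ∀ y z, f y z = f z (t y + (z - t z)) := by
    intro y z
    simpa [h3] using R 0 y z
  have C : ∀ x y z, f x y + f (t x + y) z = f (t x) (t y + z) + f y z := by
    intro x y z
    have a1 := R x (-t x) y
    have a2 := R (t x + y) (t (-t x) + (y - t y)) z
    have b1 := R x (-t x) 0
    have b2 := R (t x) (t (-t x)) (t y + z)
    simp only [h2, h3, add_neg_cancel, add_zero, map_zero, sub_zero, zero_add] at a1 b1
    have p1 : t (t x + y) + (t (-t x) + (y - t y)) = y := by simp only [map_add, map_neg]; abel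
    have p2 : t (t x) + t (-t x) = 0 := by simp
    rw [p1] at a2
    rw [p2, h3, add_zero] at b2
    have p3 : t (t x + y) + z = t (t x) + (t y + z) := by simp [add_assoc]
    have p4 : t (t (-t x) + (y - t y)) + (z - t z)
        = t (t (-t x)) + (t y + z - t (t y + z)) := by
      simp only [map_add, map_sub]; abel
    rw [p3, p4] at a2
    have e1 : f (t (t x) + (t y + z)) (t (t (-t x)) + (t y + z - t (t y + z)))
      = f (t x) (t (-t x)) - f (t x) (t y + z) := by rw [b2]; abel
    rw [e1, ← b1] at a2
    have e2 : f (t x + y) z = f (t x + y) (t (-t x) + (y - t y)) + f y z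
       - (f x (-t x) - f (t x) (t y + z)) := by rw [a2]; abel
    rw [e2, a1]; abel
  have K : ∀ x y z, f x (t y) + f (x + y) (t z) = f x (t (y + z)) + f y (t z) := by
    intro x y z
    have c := C (t.symm x) y (t z)
    rw [← T (t.symm x) y] at c
    simpa using c
  have L := comm_biadd (fun x y => f x (t y)) K
  have S : ∀ z y, f (z - t z) (t y) = f z (t y) - f y (t z) := by
    intro z y
    have c := C z (z - t z) (t y)
    have p : t (z - t z) + t y = t (y + (z - t z)) := by rw [map_add, add_comm]
    have q := A (t.symm y) z
    rw [AddEquiv.apply_symm_apply] at q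
    rw [h1, add_sub_cancel, zero_add, p, T, ← q, ← T (t.symm y) z, AddEquiv.apply_symm_apply] at c
    rw [c]; abel
  have M : ∀ x y z, f (x + y) (t z) = f x (t z) + f y (t z) := by
    intro x y z
    obtain ⟨x, rfl⟩ := ht.2 x
    obtain ⟨y, rfl⟩ := ht.2 y
    have p : x - t x + (y - t y) = (x + y) - t (x + y) := by simp only [map_add]; abel
    simp only [p, S]
    exact L x y z
  have N : ∀ x y z, f x (t (y + z)) = f x (t y) + f x (t z) := by
    intro x y z
    obtain ⟨x, rfl⟩ := ht.2 x
    have l := L y z x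
    simp only [S]
    rw [← neg_sub, l]; abel
  constructor
  · intro x y z
    simpa using M x y (t.symm z)
  · intro x y z
    simpa using N x (t.symm y) (t.symm z)

/-- **Lemma.** In the group `G` (the quotient of `ℤ⟨X × X⟩` by the stated
relations, with bracket `br a b = [a, b]`), the bracket is biadditive. -/
theorem bracket_biadditive
    {X : Type*} [AddCommGroup X] (t : X ≃+ X)
    (ht : Function.Bijective fun x : X => x - t x)
    (Rel : AddSubgroup (FreeAbelianGroup (X × X)))
    (hRel : Rel = AddSubgroup.closure
      ({z | ∃ a : X, z = of (a, a - t a)} ∪ {z | ∃ a : X, z = of (a, (0 : X))} ∪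
        {z | ∃ a : X, z = of ((0 : X), a)} ∪
        {z | ∃ x y w : X, z = of (x, w) - of (x, y) - of (t x + y, w)
          + of (t x + w, t y + (w - t w))}))
    (br : X → X → FreeAbelianGroup (X × X) ⧸ Rel)
    (hbr : ∀ a b : X, br a b = QuotientAddGroup.mk (of (a, b)))
    : (∀ x y z : X, br (x + y) z = br x z + br y z) ∧
      (∀ x y z : X, br x (y + z) = br x y + br x z) := by
  have key : ∀ z, z ∈ Rel → (QuotientAddGroup.mk z : FreeAbelianGroup (X × X) ⧸ Rel) = 0 :=
    fun z hz => (QuotientAddGroup.eq_zero_iff z).2 hz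
  have cl : ∀ z, z ∈ _ → z ∈ Rel := fun z hz => hRel ▸ AddSubgroup.subset_closure hz
  apply biadd_aux t ht br
  · intro a
    rw [hbr]
    exact key _ (cl _ (Or.inl (Or.inl (Or.inl ⟨a, rfl⟩))))
  · intro a
    rw [hbr]
    exact key _ (cl _ (Or.inl (Or.inl (Or.inr ⟨a, rfl⟩))))
  · intro a
    rw [hbr]
    exact key _ (cl _ (Or.inl (Or.inr ⟨a, rfl⟩)))
  · intro x y w
    have h := key _ (cl _ (Or.inr ⟨x, y, w, rfl⟩))
    rw [QuotientAddGroup.mk_add, QuotientAddGroup.mk_sub, QuotientAddGroup.mk_sub] at h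
    simp only [← hbr] at h
    rw [← sub_eq_zero, ← neg_eq_zero, ← h]
    abel
end
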